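/- Let t ≥ 1 be an integer. Every finite simple Eulerian digraph in which every vertex has outdegree at least t(t-1) contains an immersion of the bidirected complete digraph K⃗_t. -/

import Mathlib

/-- `H` is immersed in `G` via the injective branch-vertex map `φ`:
for each edge `ab` of `H` there is a path in `G` from `φ a` to `φ b`,
and paths corresponding to distinct edges are pairwise edge-disjoint. -/
def SimpleGraph.ImmersionVia {W V : Type*} (H : SimpleGraph W) (G : SimpleGraph V)
    (φ : W → V) : Prop :=
  Function.Injective φ ∧
  ∃ P : ∀ ⦃a b : W⦄, H.Adj a b → G.Walk (φ a) (φ b),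
    (∀ ⦃a b⦄ (h : H.Adj a b), (P h).IsPath) ∧
    (∀ ⦃a b a' b'⦄ (h : H.Adj a b) (h' : H.Adj a' b'),
      s(a, b) ≠ s(a', b') → ∀ e ∈ (P h).edges, e ∉ (P h').edges)

/-- `H` is immersed in `G`. -/
def SimpleGraph.Immersion {W V : Type*} (H : SimpleGraph W) (G : SimpleGraph V) : Prop :=
  ∃ φ : W → V, H.ImmersionVia G φ

/-- The edge-cut `δ(X)`: edges of `G` with exactly one endpoint in `X`. -/
def SimpleGraph.cutEdges {V : Type*} (G : SimpleGraph V) (X : Set V) : Set (Sym2 V) :=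
  {e | e ∈ G.edgeSet ∧ ∃ a b, e = s(a, b) ∧ a ∈ X ∧ b ∉ X}

/-- A family of vertex sets is laminar (pairwise uncrossed). -/
def IsLaminar {V : Type*} (F : Set (Set V)) : Prop :=
  ∀ X ∈ F, ∀ Y ∈ F, X ⊆ Y ∨ X ⊆ Yᶜ ∨ Xᶜ ⊆ Y ∨ Xᶜ ⊆ Yᶜ

/-- The block containing `v` of the vertex partition induced by the family `F`. -/
def laminarBlock {V : Type*} (F : Set (Set V)) (v : V) : Set V :=
  {u | ∀ X ∈ F, (u ∈ X ↔ v ∈ X)}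

/-- A directed path from `x` to `y` in the digraph with adjacency relation `A`,
recorded as its (nonempty, duplicate-free) list of vertices. -/
def IsDiPath {V : Type*} (A : V → V → Prop) (x y : V) (l : List V) : Prop :=
  List.Chain' A l ∧ l.head? = some x ∧ l.getLast? = some y ∧ l.Nodup

/-- The directed edges traversed by a directed walk given by its vertex list. -/
def diWalkEdges {V : Type*} (l : List V) : List (V × V) := l.zip l.tail

/-- The digraph `F` is immersed in the digraph `A` via the injective map `φ`. -/
def DiImmersionVia {W V : Type*} (F : W → W → Prop) (A : V → V → Prop) (φ : W → V) : Prop :=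
  Function.Injective φ ∧
  ∃ P : ∀ ⦃a b : W⦄, F a b → List V,
    (∀ ⦃a b⦄ (h : F a b), IsDiPath A (φ a) (φ b) (P h)) ∧
    (∀ ⦃a b a' b'⦄ (h : F a b) (h' : F a' b'),
      (a, b) ≠ (a', b') → ∀ e ∈ diWalkEdges (P h), e ∉ diWalkEdges (P h'))

/-- The digraph `F` is immersed in the digraph `A`. -/
def DiImmersion {W V : Type*} (F : W → W → Prop) (A : V → V → Prop) : Prop :=
  ∃ φ : W → V, DiImmersionVia F A φ

/-- The edge-cut `δ(X)` of a digraph: edges with exactly one endpoint in `X`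
(in either direction). -/
def diCutEdges {V : Type*} (A : V → V → Prop) (X : Set V) : Set (V × V) :=
  {p | A p.1 p.2 ∧ ¬ (p.1 ∈ X ↔ p.2 ∈ X)}

/-- The outdegree of `v` in the digraph `A`. -/
noncomputable def diOutDeg {V : Type*} (A : V → V → Prop) (v : V) : ℕ := {u | A v u}.ncard

/-- The indegree of `v` in the digraph `A`. -/
noncomputable def diInDeg {V : Type*} (A : V → V → Prop) (v : V) : ℕ := {u | A u v}.ncard

/-- An Eulerian digraph: loopless, and every vertex has indegree equal to outdegree. -/
def IsEulerianDigraph {V : Type*} (A : V → V → Prop) : Prop :=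
  (∀ v, ¬ A v v) ∧ ∀ v : V, diInDeg A v = diOutDeg A v

/-- The bidirected complete digraph `K⃗ₜ` on `Fin t`. -/
def bidirComplete (t : ℕ) : Fin t → Fin t → Prop := fun a b => a ≠ b

open Classical in
/-- The indicator function of a set, with integer values. -/
noncomputable def setInd {V : Type*} (Z : Set V) (v : V) : ℤ := if v ∈ Z then 1 else 0

/-- The number of arcs of `S` leaving `Z`. -/
noncomputable def outCut {V : Type*} (S : Finset (V × V)) (Z : Set V) : ℤ :=
  ∑ e ∈ S, setInd Z e.1 * (1 - setInd Z e.2)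

/-- The number of arcs of `S` leaving `Z` minus the number of arcs of `S` entering `Z`. -/
noncomputable def netOut {V : Type*} (S : Finset (V × V)) (Z : Set V) : ℤ :=
  ∑ e ∈ S, (setInd Z e.1 - setInd Z e.2)

section Cuts

variable {V : Type*}

theorem setInd_of_mem {Z : Set V} {v : V} (h : v ∈ Z) : setInd Z v = 1 := by simp [setInd, h]

theorem setInd_of_notMem {Z : Set V} {v : V} (h : v ∉ Z) : setInd Z v = 0 := by simp [setInd, h]

theorem setInd_eq_zero_or_one (Z : Set V) (v : V) : setInd Z v = 0 ∨ setInd Z v = 1 := by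
  unfold setInd; split_ifs <;> simp

theorem setInd_inter (Y Z : Set V) (v : V) : setInd (Y ∩ Z) v = setInd Y v * setInd Z v := by
  by_cases hY : v ∈ Y <;> by_cases hZ : v ∈ Z <;> simp [setInd, hY, hZ]

theorem setInd_union (Y Z : Set V) (v : V) :
    setInd (Y ∪ Z) v = setInd Y v + setInd Z v - setInd Y v * setInd Z v := by
  by_cases hY : v ∈ Y <;> by_cases hZ : v ∈ Z <;> simp [setInd, hY, hZ]

theorem setInd_compl (Z : Set V) (v : V) : setInd Zᶜ v = 1 - setInd Z v := by
  by_cases hZ : v ∈ Z <;> simp [setInd, hZ]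

theorem setInd_inter_add_union (Y Z : Set V) (v : V) :
    setInd (Y ∩ Z) v + setInd (Y ∪ Z) v = setInd Y v + setInd Z v := by
  rw [setInd_inter, setInd_union]; ring

theorem arc_cut_nonneg (Z : Set V) (e : V × V) : 0 ≤ setInd Z e.1 * (1 - setInd Z e.2) := by
  rcases setInd_eq_zero_or_one Z e.1 with h | h <;>
  rcases setInd_eq_zero_or_one Z e.2 with h' | h' <;> simp [h, h']

theorem outCut_nonneg (S : Finset (V × V)) (Z : Set V) : 0 ≤ outCut S Z :=
  Finset.sum_nonneg fun e _ => arc_cut_nonneg Z e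

theorem netOut_eq_sub (S : Finset (V × V)) (Z : Set V) :
    netOut S Z = outCut S Z - outCut S Zᶜ := by
  unfold netOut outCut
  rw [← Finset.sum_sub_distrib]
  refine Finset.sum_congr rfl fun e _ => ?_
  rw [setInd_compl, setInd_compl]; ring

theorem netOut_le_outCut (S : Finset (V × V)) (Z : Set V) : netOut S Z ≤ outCut S Z := by
  have := outCut_nonneg S Zᶜ
  rw [netOut_eq_sub]; linarith

theorem arc_cut_submodular (Y Z : Set V) (e : V × V) :
    setInd (Y ∩ Z) e.1 * (1 - setInd (Y ∩ Z) e.2) +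
      setInd (Y ∪ Z) e.1 * (1 - setInd (Y ∪ Z) e.2) ≤
    setInd Y e.1 * (1 - setInd Y e.2) + setInd Z e.1 * (1 - setInd Z e.2) := by
  simp only [setInd_inter, setInd_union]
  rcases setInd_eq_zero_or_one Y e.1 with h | h <;>
  rcases setInd_eq_zero_or_one Y e.2 with h' | h' <;>
  rcases setInd_eq_zero_or_one Z e.1 with h'' | h'' <;>
  rcases setInd_eq_zero_or_one Z e.2 with h''' | h''' <;> simp [h, h', h'', h''']

theorem outCut_submodular (S : Finset (V × V)) (Y Z : Set V) :
    outCut S (Y ∩ Z) + outCut S (Y ∪ Z) ≤ outCut S Y + outCut S Z := by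
  unfold outCut
  rw [← Finset.sum_add_distrib, ← Finset.sum_add_distrib]
  exact Finset.sum_le_sum fun e _ => arc_cut_submodular Y Z e

/-- An integral feasibility theorem for unit capacities: a modular demand function which vanishes
on the empty and the full set and is bounded by the out-cuts of `S` is the net outflow of a
subset of `S`. -/
theorem exists_subset_netOut_eq (S : Finset (V × V)) : ∀ b : Set V → ℤ,
    (∀ Y Z, b (Y ∩ Z) + b (Y ∪ Z) = b Y + b Z) → b ∅ = 0 → b Set.univ = 0 →
    (∀ Z, b Z ≤ outCut S Z) → ∃ E ⊆ S, ∀ Z, netOut E Z = b Z := by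
  classical
  induction S using Finset.induction_on with
  | empty =>
    intro b hmod h0 h1 hb
    refine ⟨∅, subset_rfl, fun Z => ?_⟩
    have hZ := hb Z
    have hZc := hb Zᶜ
    have hm := hmod Z Zᶜ
    simp only [Set.inter_compl_self, Set.union_compl_self, h0, h1] at hm
    simp only [outCut, netOut, Finset.sum_empty] at *
    linarith
  | insert e S he ih =>
    intro b hmod h0 h1 hb
    have hcut : ∀ Z, outCut (insert e S) Z =
        setInd Z e.1 * (1 - setInd Z e.2) + outCut S Z := fun Z => Finset.sum_insert he
    by_cases hdel : ∀ Z, b Z ≤ outCut S Z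
    · obtain ⟨E, hE, hnet⟩ := ih b hmod h0 h1 hdel
      exact ⟨E, hE.trans (Finset.subset_insert _ _), hnet⟩
    by_cases hcom : ∀ Z, b Z - (setInd Z e.1 - setInd Z e.2) ≤ outCut S Z
    · obtain ⟨E, hE, hnet⟩ := ih (fun Z => b Z - (setInd Z e.1 - setInd Z e.2))
        (fun Y Z => by
          have h2 := setInd_inter_add_union Y Z e.1
          have h3 := setInd_inter_add_union Y Z e.2
          have h4 := hmod Y Z
          linarith)
        (by simp [h0, setInd]) (by simp [h1, setInd]) hcom
      refine ⟨insert e E, Finset.insert_subset_insert _ hE, fun Z => ?_⟩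
      have h2 : netOut (insert e E) Z = (setInd Z e.1 - setInd Z e.2) + netOut E Z :=
        Finset.sum_insert fun h => he (hE h)
      rw [h2, hnet]; ring
    exfalso
    push Not at hdel hcom
    obtain ⟨Y, hY⟩ := hdel
    obtain ⟨Z, hZ⟩ := hcom
    have hbY := hb Y
    have hbZ := hb Z
    have hbi := hb (Y ∩ Z)
    have hbu := hb (Y ∪ Z)
    have hm := hmod Y Z
    have hs := outCut_submodular S Y Z
    rw [hcut] at hbY hbZ hbi hbu
    simp only [setInd_inter, setInd_union] at hbi hbu
    rcases setInd_eq_zero_or_one Y e.1 with h | h <;>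
    rcases setInd_eq_zero_or_one Y e.2 with h' | h' <;>
    rcases setInd_eq_zero_or_one Z e.1 with h'' | h'' <;>
    rcases setInd_eq_zero_or_one Z e.2 with h''' | h''' <;>
    simp only [h, h', h'', h'''] at * <;> linarith

/-- An arc set whose net outflow is that of a family of demands, all with the same target or all
with the same source, splits into disjoint arc sets each serving one demand. -/
theorem exists_disjoint_netOut_eq {ι : Type*} (x y : ι → V) (r : V)
    (hr : (∀ i, y i = r) ∨ (∀ i, x i = r)) (I : Finset ι) : ∀ S : Finset (V × V),
    (∀ Z, netOut S Z = ∑ i ∈ I, (setInd Z (x i) - setInd Z (y i))) →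
    ∃ E : ι → Finset (V × V), (∀ i ∈ I, E i ⊆ S) ∧
      (∀ i ∈ I, ∀ Z, netOut (E i) Z = setInd Z (x i) - setInd Z (y i)) ∧
      (∀ i ∈ I, ∀ j ∈ I, i ≠ j → Disjoint (E i) (E j)) := by
  classical
  induction I using Finset.induction_on with
  | empty => intro S _; exact ⟨fun _ => ∅, by simp⟩
  | insert i I hi ih =>
    intro S hS
    obtain ⟨F, hFS, hF⟩ := exists_subset_netOut_eq S
      (fun Z => setInd Z (x i) - setInd Z (y i))
      (fun Y Z => by
        have h2 := setInd_inter_add_union Y Z (x i)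
        have h3 := setInd_inter_add_union Y Z (y i)
        linarith)
      (by simp [setInd]) (by simp [setInd])
      (fun Z => by
        have hle := netOut_le_outCut S Z
        have hnn := outCut_nonneg S Z
        rcases setInd_eq_zero_or_one Z (x i) with h | h <;>
        rcases setInd_eq_zero_or_one Z (y i) with h' | h' <;> try (rw [h, h']; linarith)
        have hrest : 0 ≤ ∑ j ∈ I, (setInd Z (x j) - setInd Z (y j)) := by
          refine Finset.sum_nonneg fun j _ => ?_
          rcases hr with hr | hr
          · rw [hr j, ← hr i, h']
            rcases setInd_eq_zero_or_one Z (x j) with h'' | h'' <;> simp [h'']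
          · rw [hr j, ← hr i, h]
            rcases setInd_eq_zero_or_one Z (y j) with h'' | h'' <;> simp [h'']
        rw [hS, Finset.sum_insert hi] at hle
        linarith)
    obtain ⟨E, hES, hE, hdisj⟩ := ih (S \ F) (fun Z => by
      have h2 : netOut (S \ F) Z + netOut F Z = netOut S Z := Finset.sum_sdiff hFS
      have h3 := hS Z
      rw [Finset.sum_insert hi] at h3
      have h4 := hF Z
      linarith)
    have hne : ∀ j ∈ I, j ≠ i := fun j hj h => hi (h ▸ hj)
    have hFE : ∀ j ∈ I, Disjoint F (E j) := fun j hj =>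
      Finset.disjoint_sdiff.mono_right (hES j hj)
    refine ⟨Function.update E i F, ?_, ?_, ?_⟩
    · intro j hj
      rcases Finset.mem_insert.1 hj with rfl | hj
      · simpa using hFS
      · simpa [hne j hj] using (hES j hj).trans Finset.sdiff_subset
    · intro j hj
      rcases Finset.mem_insert.1 hj with rfl | hj
      · simpa using hF
      · simpa [hne j hj] using hE j hj
    · intro j hj l hl hjl
      rcases Finset.mem_insert.1 hj with rfl | hj' <;> rcases Finset.mem_insert.1 hl with rfl | hl'
      · exact absurd rfl hjl
      · simpa [hne l hl'] using hFE l hl'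
      · simpa [hne j hj'] using (hFE j hj').symm
      · simpa [hne j hj', hne l hl'] using hdisj j hj' l hl' hjl

theorem reflTransGen_of_netOut_eq {E : Finset (V × V)} {x y : V}
    (h : ∀ Z, netOut E Z = setInd Z x - setInd Z y) :
    Relation.ReflTransGen (fun a b => (a, b) ∈ E) x y := by
  by_contra hy
  let R : Set V := {v | Relation.ReflTransGen (fun a b => (a, b) ∈ E) x v}
  have hx : x ∈ R := Relation.ReflTransGen.refl
  have hR := h R
  rw [setInd_of_mem hx, setInd_of_notMem (show y ∉ R from hy)] at hR
  have h0 : outCut E R = 0 := by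
    refine Finset.sum_eq_zero fun e he => ?_
    by_cases h1 : e.1 ∈ R
    · have h2 : e.2 ∈ R := Relation.ReflTransGen.tail h1 he
      simp [setInd_of_mem h2]
    · simp [setInd_of_notMem h1]
  have := netOut_le_outCut E R
  linarith

/-- A symmetric submodular set function on a finite set admits a nonempty set `X`, of value less
than `k` unless it is everything, no two points of which are separated by a set of value less
than `k`. -/
theorem exists_highly_connected_set [Finite V] [Nonempty V] (d : Set V → ℤ)
    (hsymm : ∀ Z, d Zᶜ = d Z) (hsub : ∀ Y Z, d (Y ∩ Z) + d (Y ∪ Z) ≤ d Y + d Z) (k : ℤ) :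
    ∃ X : Set V, X.Nonempty ∧ (X = Set.univ ∨ d X < k) ∧
      ∀ Z, ∀ u ∈ X, ∀ v ∈ X, u ∈ Z → v ∉ Z → k ≤ d Z := by
  let IsMinCut (X : Set V) (s t : V) : Prop :=
    s ∈ X ∧ t ∉ X ∧ d X < k ∧ ∀ Y, s ∈ Y → t ∉ Y → d X ≤ d Y
  have hex : ∀ Z u v, u ∈ Z → v ∉ Z → d Z < k → ∃ Y, IsMinCut Y u v := by
    intro Z u v hu hv hd
    obtain ⟨Y, ⟨huY, hvY⟩, hY⟩ := Set.exists_min_image {Y : Set V | u ∈ Y ∧ v ∉ Y} d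
      (Set.toFinite _) ⟨Z, hu, hv⟩
    exact ⟨Y, huY, hvY, (hY Z ⟨hu, hv⟩).trans_lt hd, fun W h1 h2 => hY W ⟨h1, h2⟩⟩
  by_cases hne : ∃ X, ∃ s t, IsMinCut X s t
  · obtain ⟨X, hX⟩ := (Set.toFinite {X | ∃ s t, IsMinCut X s t}).exists_minimal hne
    obtain ⟨⟨s, t, hs, ht, hdX, hXmin⟩, hmin⟩ := hX
    have key : ∀ Z, ∀ u ∈ X, ∀ v ∈ X, IsMinCut Z u v → t ∉ Z → False := by
      rintro Z u huX v hvX ⟨hu, hv, hdZ, hZmin⟩ htZ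
      have h1 := hXmin (X ∪ Z) (Or.inl hs) (by simp [ht, htZ])
      have h2 := hsub X Z
      have h3 : d (X ∩ Z) ≤ d Z := by linarith
      have h4 : IsMinCut (X ∩ Z) u v := ⟨⟨huX, hu⟩, fun h => hv h.2, h3.trans_lt hdZ,
        fun Y hY1 hY2 => h3.trans (hZmin Y hY1 hY2)⟩
      exact hv (hmin ⟨u, v, h4⟩ Set.inter_subset_left hvX).2
    refine ⟨X, ⟨s, hs⟩, Or.inr hdX, fun Z u hu v hv huZ hvZ => ?_⟩
    by_contra hlt
    obtain ⟨Y, hY⟩ := hex Z u v huZ hvZ (not_le.1 hlt)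
    by_cases htY : t ∈ Y
    · obtain ⟨huY, hvY, hdY, hYmin⟩ := hY
      refine key Yᶜ v hv u hu ⟨hvY, fun h => h huY, by rwa [hsymm], fun W h1 h2 => ?_⟩
        (fun h => h htY)
      rw [hsymm, ← hsymm W]
      exact hYmin Wᶜ h2 (fun h => h h1)
    · exact key Y u hu v hv hY htY
  · refine ⟨Set.univ, Set.univ_nonempty, Or.inl rfl, fun Z u _ v _ hu hv => ?_⟩
    by_contra hlt
    obtain ⟨Y, hY⟩ := hex Z u v hu hv (not_le.1 hlt)
    exact hne ⟨Y, u, v, hY⟩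

theorem exists_isDiPath_of_reflTransGen {R : V → V → Prop} {x y : V}
    (h : Relation.ReflTransGen R x y) : ∃ l, IsDiPath R x y l := by
  induction h using Relation.ReflTransGen.head_induction_on with
  | refl => exact ⟨[y], List.isChain_singleton y, by simp⟩
  | @head a b hab _ ih =>
    obtain ⟨l, hc, hh, hl, hn⟩ := ih
    by_cases ha : a ∈ l
    · obtain ⟨s, u, rfl⟩ := List.append_of_mem ha
      refine ⟨a :: u, (List.isChain_append.1 hc).2.1, rfl, ?_, (List.nodup_append.1 hn).2.1⟩
      simpa [List.getLast?_append] using hl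
    · cases l with
      | nil => simp at hh
      | cons c l =>
        simp only [List.head?_cons, Option.some.injEq] at hh
        subst hh
        exact ⟨a :: c :: l, List.isChain_cons_cons.2 ⟨hab, hc⟩, rfl, by simpa using hl,
          List.nodup_cons.2 ⟨ha, hn⟩⟩

theorem rel_of_mem_diWalkEdges {R : V → V → Prop} : ∀ {l : List V}, List.IsChain R l →
    ∀ e ∈ diWalkEdges l, R e.1 e.2
  | [], _, e, he => by simp [diWalkEdges] at he
  | [_], _, e, he => by simp [diWalkEdges] at he
  | a :: b :: l, h, e, he => by
    rw [List.isChain_cons_cons] at h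
    simp only [diWalkEdges, List.tail_cons, List.zip_cons_cons, List.mem_cons] at he
    rcases he with rfl | he
    · exact h.1
    · exact rel_of_mem_diWalkEdges h.2 e he

theorem diImmersion_of_netOut {W : Type*} {F : W → W → Prop} {A : V → V → Prop} {φ : W → V}
    (hφ : Function.Injective φ) (E : W × W → Finset (V × V))
    (hA : ∀ a b, F a b → ∀ e ∈ E (a, b), A e.1 e.2)
    (hnet : ∀ a b, F a b → ∀ Z, netOut (E (a, b)) Z = setInd Z (φ a) - setInd Z (φ b))
    (hdisj : ∀ a b a' b', F a b → F a' b' → (a, b) ≠ (a', b') →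
      Disjoint (E (a, b)) (E (a', b'))) : DiImmersion F A := by
  have hpath : ∀ a b, F a b → ∃ l, IsDiPath (fun u v => (u, v) ∈ E (a, b)) (φ a) (φ b) l :=
    fun a b h => exists_isDiPath_of_reflTransGen (reflTransGen_of_netOut_eq (hnet a b h))
  choose P hP using hpath
  refine ⟨φ, hφ, fun a b h => P a b h, fun a b h => ?_, fun a b a' b' h h' hne e he he' => ?_⟩
  · obtain ⟨h1, h2⟩ := hP a b h
    exact ⟨List.IsChain.imp (fun u v huv => hA a b h _ huv) h1, h2⟩
  · exact Finset.disjoint_left.1 (hdisj a b a' b' h h' hne)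
      (rel_of_mem_diWalkEdges (hP a b h).1 e he) (rel_of_mem_diWalkEdges (hP a' b' h').1 e he')

theorem diImmersion_bidirComplete_of_cuts {t : ℕ} {A : V → V → Prop} {S : Finset (V × V)}
    (hSA : ∀ e ∈ S, A e.1 e.2) (hEul : ∀ Z, netOut S Z = 0) {φ : Fin t → V}
    (hφ : Function.Injective φ)
    (hcut : ∀ Z a b, φ a ∈ Z → φ b ∉ Z → ((t * (t - 1) : ℕ) : ℤ) ≤ outCut S Z) :
    DiImmersion (bidirComplete t) A := by
  classical
  rcases isEmpty_or_nonempty (Fin t) with hemp | ⟨⟨z⟩⟩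
  · exact ⟨φ, hφ, fun a => hemp.elim a, fun a => hemp.elim a, fun a => hemp.elim a⟩
  let I : Finset (Fin t × Fin t) := Finset.univ.offDiag
  have hI : I.card = t * (t - 1) := by
    simp [I, Finset.offDiag_card, Nat.mul_sub]
  have hmem : ∀ a b, (a, b) ∈ I ↔ a ≠ b := fun a b => by simp [I]
  obtain ⟨T, hTS, hT⟩ := exists_subset_netOut_eq S
    (fun Z => ∑ p ∈ I, (setInd Z (φ p.1) - setInd Z (φ z)))
    (fun Y Z => by
      rw [← Finset.sum_add_distrib, ← Finset.sum_add_distrib]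
      refine Finset.sum_congr rfl fun p _ => ?_
      have h2 := setInd_inter_add_union Y Z (φ p.1)
      have h3 := setInd_inter_add_union Y Z (φ z)
      linarith)
    (by simp [setInd]) (by simp [setInd])
    (fun Z => by
      by_cases hsep : φ z ∉ Z ∧ ∃ a, φ a ∈ Z
      · obtain ⟨hz, a, ha⟩ := hsep
        refine le_trans ?_ (hcut Z a z ha hz)
        rw [← hI]
        refine (Finset.sum_le_card_nsmul I _ 1 fun p _ => ?_).trans (by simp)
        rw [setInd_of_notMem hz]
        rcases setInd_eq_zero_or_one Z (φ p.1) with h | h <;> simp [h]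
      · refine (Finset.sum_nonpos fun p _ => ?_).trans (outCut_nonneg S Z)
        by_cases hz : φ z ∈ Z
        · rw [setInd_of_mem hz]
          rcases setInd_eq_zero_or_one Z (φ p.1) with h | h <;> simp [h]
        · have hp : φ p.1 ∉ Z := fun h => hsep ⟨hz, p.1, h⟩
          simp [setInd_of_notMem hz, setInd_of_notMem hp])
  have hswap : ∀ f : Fin t → ℤ, ∑ p ∈ I, f p.1 = ∑ p ∈ I, f p.2 := fun f =>
    Finset.sum_nbij' Prod.swap Prod.swap (by simp [I, eq_comm]) (by simp [I, eq_comm])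
      (by simp) (by simp) (by simp)
  obtain ⟨E₁, hE₁T, hE₁, hd₁⟩ := exists_disjoint_netOut_eq (fun p : Fin t × Fin t => φ p.1)
    (fun _ => φ z) (φ z) (Or.inl fun _ => rfl) I T hT
  obtain ⟨E₂, hE₂T, hE₂, hd₂⟩ := exists_disjoint_netOut_eq (fun _ => φ z)
    (fun p : Fin t × Fin t => φ p.2) (φ z) (Or.inr fun _ => rfl) I (S \ T) (fun Z => by
      have h2 : netOut (S \ T) Z + netOut T Z = netOut S Z := Finset.sum_sdiff hTS
      have h3 := hswap fun a => setInd Z (φ a)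
      rw [hT, hEul, Finset.sum_sub_distrib] at h2
      rw [Finset.sum_sub_distrib]
      linarith)
  have hd₁₂ : ∀ p ∈ I, ∀ q ∈ I, Disjoint (E₁ p) (E₂ q) := fun p hp q hq =>
    Finset.disjoint_sdiff.mono (hE₁T p hp) (hE₂T q hq)
  refine diImmersion_of_netOut hφ (fun p => E₁ p ∪ E₂ p) (fun a b h e he => ?_)
    (fun a b h Z => ?_) (fun a b a' b' h h' hne => ?_)
  · rcases Finset.mem_union.1 he with he | he
    · exact hSA e (hTS (hE₁T _ ((hmem a b).2 h) he))
    · exact hSA e (Finset.sdiff_subset (hE₂T _ ((hmem a b).2 h) he))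
  · have hab := (hmem a b).2 h
    have h1 : netOut (E₁ (a, b) ∪ E₂ (a, b)) Z = netOut (E₁ (a, b)) Z + netOut (E₂ (a, b)) Z :=
      Finset.sum_union (hd₁₂ _ hab _ hab)
    have h2 := hE₁ _ hab Z
    have h3 := hE₂ _ hab Z
    dsimp only at *
    linarith
  · have hab := (hmem a b).2 h
    have hab' := (hmem a' b').2 h'
    rw [Finset.disjoint_union_left, Finset.disjoint_union_right, Finset.disjoint_union_right]
    exact ⟨⟨hd₁ _ hab _ hab' hne, hd₁₂ _ hab _ hab'⟩,
      (hd₁₂ _ hab' _ hab).symm, hd₂ _ hab _ hab' hne⟩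

/-- A nonempty vertex set with few leaving arcs, in a simple digraph of large minimum outdegree,
is large. -/
theorem le_card_of_outCut_lt {t : ℕ} (X : Finset V) (hX : X.Nonempty) (S : Finset (V × V))
    (hloop : ∀ v, (v, v) ∉ S)
    (hdeg : ∀ x, ((t * (t - 1) : ℕ) : ℤ) ≤ ∑ e ∈ S, setInd {x} e.1)
    (hcut : outCut S X < ((t * (t - 1) : ℕ) : ℤ) ∨ outCut S X = 0) : t ≤ X.card := by
  classical
  by_contra hlt
  have hm : 1 ≤ X.card := hX.card_pos
  have hsum : ∑ e ∈ S, setInd (X : Set V) e.1 = ∑ x ∈ X, ∑ e ∈ S, setInd {x} e.1 := by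
    rw [Finset.sum_comm]
    refine Finset.sum_congr rfl fun e _ => ?_
    simp [setInd]
  have hlow : (X.card : ℤ) * ((t * (t - 1) : ℕ) : ℤ) ≤ ∑ e ∈ S, setInd (X : Set V) e.1 := by
    rw [hsum, ← nsmul_eq_mul]
    exact Finset.card_nsmul_le_sum X _ _ fun x _ => hdeg x
  have hsplit : ∑ e ∈ S, setInd (X : Set V) e.1 =
      outCut S X + ∑ e ∈ S, setInd (X : Set V) e.1 * setInd (X : Set V) e.2 := by
    unfold outCut
    rw [← Finset.sum_add_distrib]
    exact Finset.sum_congr rfl fun e _ => by ring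
  have hin : ∑ e ∈ S, setInd (X : Set V) e.1 * setInd (X : Set V) e.2 ≤ (X.offDiag.card : ℤ) := by
    have h1 : ∑ e ∈ S, setInd (X : Set V) e.1 * setInd (X : Set V) e.2 =
        ((S.filter fun e => e.1 ∈ X ∧ e.2 ∈ X).card : ℤ) := by
      rw [Finset.card_filter]
      push_cast
      refine Finset.sum_congr rfl fun e _ => ?_
      by_cases h1 : e.1 ∈ X <;> by_cases h2 : e.2 ∈ X <;> simp [setInd, h1, h2]
    rw [h1]
    refine Nat.cast_le.2 (Finset.card_le_card ?_)
    rintro ⟨a, b⟩ h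
    simp only [Finset.mem_filter] at h
    refine Finset.mem_offDiag.2 ⟨h.2.1, h.2.2, fun hab => ?_⟩
    dsimp only at hab
    subst hab
    exact hloop _ h.1
  have hoff : (X.offDiag.card : ℤ) = X.card * X.card - X.card := by
    rw [Finset.offDiag_card, Nat.cast_sub (Nat.le_mul_self _)]
    push_cast; ring
  have hk : (X.card : ℤ) ≤ ((t * (t - 1) : ℕ) : ℤ) := by
    have : X.card ≤ t - 1 := by omega
    exact Nat.cast_le.2 (this.trans (Nat.le_mul_of_pos_left _ (by omega)))
  have hm' : (1 : ℤ) ≤ X.card := by exact_mod_cast hm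
  generalize ((t * (t - 1) : ℕ) : ℤ) = k at *
  generalize (X.card : ℤ) = m at *
  rcases hcut with hcut | hcut
  · nlinarith
  · nlinarith

end Cuts

/-- Every finite simple Eulerian digraph with minimum outdegree at least
`t(t-1)` contains an immersion of the bidirected complete digraph `K⃗_t`. -/
theorem stmt_6 {V : Type*} [Fintype V] [Nonempty V] (t : ℕ) (ht : 1 ≤ t)
    (A : V → V → Prop) (hEul : IsEulerianDigraph A)
    (hdeg : ∀ x : V, t * (t - 1) ≤ diOutDeg A x) :
    DiImmersion (bidirComplete t) A := by
  classical
  let S : Finset (V × V) := Finset.univ.filter fun e => A e.1 e.2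
  have hS : ∀ e, e ∈ S ↔ A e.1 e.2 := fun e => by simp [S]
  have hout : ∀ v, ∑ e ∈ S, setInd {v} e.1 = diOutDeg A v := by
    intro v
    simp only [S, Finset.sum_filter, Fintype.sum_prod_type, diOutDeg, setInd]
    rw [Finset.sum_eq_single v (by intro b _ hb; simp [hb]) (by simp)]
    simp [Set.ncard_eq_toFinset_card']
  have hin : ∀ v, ∑ e ∈ S, setInd {v} e.2 = diInDeg A v := by
    intro v
    simp only [S, Finset.sum_filter, Fintype.sum_prod_type_right, diInDeg, setInd]
    rw [Finset.sum_eq_single v (by intro b _ hb; simp [hb]) (by simp)]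
    simp [Set.ncard_eq_toFinset_card']
  have hind : ∀ (Z : Set V) (u : V), setInd Z u = ∑ v ∈ Z.toFinset, setInd {v} u := by
    intro Z u
    simp [setInd]
  have hnet : ∀ Z, netOut S Z = 0 := by
    intro Z
    unfold netOut
    rw [Finset.sum_sub_distrib]
    simp only [hind Z]
    rw [Finset.sum_comm, Finset.sum_comm (s := S), sub_eq_zero]
    exact Finset.sum_congr rfl fun v _ => by rw [hout, hin, hEul.2]
  obtain ⟨X, hXne, hX, hXcut⟩ := exists_highly_connected_set (outCut S)
    (fun Z => by have := netOut_eq_sub S Z; rw [hnet] at this; linarith)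
    (outCut_submodular S) ((t * (t - 1) : ℕ) : ℤ)
  have hcard : t ≤ X.toFinset.card := by
    refine le_card_of_outCut_lt X.toFinset (by simpa using hXne) S
      (fun v hv => hEul.1 v ((hS _).1 hv)) (fun x => ?_) ?_
    · rw [hout]
      exact_mod_cast hdeg x
    · rw [Set.coe_toFinset]
      rcases hX with rfl | hX
      · exact Or.inr (Finset.sum_eq_zero fun e _ => by simp [setInd])
      · exact Or.inl hX
  obtain ⟨Y, hYX, hYt⟩ := Finset.exists_subset_card_eq hcard
  let φ := (Y.equivFinOfCardEq hYt).symm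
  have hφ : ∀ a, (φ a : V) ∈ X := fun a => by simpa using hYX (φ a).2
  exact diImmersion_bidirComplete_of_cuts (fun e he => (hS e).1 he) hnet
    (φ := fun a => (φ a : V)) (Subtype.val_injective.comp φ.injective)
    (fun Z a b ha hb => hXcut Z _ (hφ a) _ (hφ b) ha hb)
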